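/- For every nonempty independent subset K ⊆ V, the function Δ_K is an element of the graph equivariant cohomology H*(GQ_{2n−1}); that is, for every pair of distinct vertices i, j ∈ V, the polynomial α(ij) divides Δ_K(i) − Δ_K(j) in R. -/

import Mathlib

open MvPolynomial Finset

noncomputable section

abbrev Rr (n : ℕ) := MvPolynomial (Fin n) ℤ

/-- The "opposite" vertex: 0-indexed version of i ↦ 2n+1−i. -/
def bar {n : ℕ} (i : Fin (2*n)) : Fin (2*n) :=
  ⟨2*n - 1 - i.val, by have := i.isLt; omega⟩

/-- The weight α_i (0-indexed): α_i = X i for i < n, and α_i = −α_{bar i} otherwise. -/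
def av {n : ℕ} (i : Fin (2*n)) : Rr n :=
  if h : i.val < n then X ⟨i.val, h⟩
  else - X ⟨2*n - 1 - i.val, by have := i.isLt; omega⟩

/-- The axial function α(ij). -/
def ax {n : ℕ} (i j : Fin (2*n)) : Rr n :=
  if j = bar i then - av i else - av i + av j

/-- The class M_v. -/
def Mv {n : ℕ} (v : Fin (2*n)) : Fin (2*n) → Rr n := fun j =>
  if j = v then 0 else if j = bar v then 2 * av v else - av j + av v

/-- The class Q. -/
def Qf {n : ℕ} : Fin (2*n) → Rr n := fun j => - av j

/-- Independence: K contains no pair {i, bar i}. -/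
def indep {n : ℕ} (K : Finset (Fin (2*n))) : Prop :=
  ∀ i : Fin (2*n), ¬ ({i, bar i} : Finset (Fin (2*n))) ⊆ K

/-- The class Δ_K. -/
def Del {n : ℕ} (K : Finset (Fin (2*n))) : Fin (2*n) → Rr n := fun j =>
  if j ∈ K then ∏ k ∈ Kᶜ, ax j k else 0

/-- The class Δ'_K. -/
def Del' {n : ℕ} (K : Finset (Fin (2*n))) : Fin (2*n) → Rr n := fun j =>
  if j ∈ K then ∏ k ∈ (K ∪ {bar j})ᶜ, ax j k else 0

/-- The graph equivariant cohomology H*(GQ_{2n−1}) as a subring of the ring of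
functions V → R with pointwise operations. -/
def HGQ (n : ℕ) : Subring (Fin (2*n) → Rr n) where
  carrier := {f | ∀ i j : Fin (2*n), i ≠ j → ax i j ∣ f i - f j}
  zero_mem' := fun i j _ => by simp
  one_mem' := fun i j _ => by simp
  add_mem' := by
    intro a b ha hb i j h
    have e : (a + b) i - (a + b) j = (a i - a j) + (b i - b j) := by
      simp only [Pi.add_apply]; ring
    rw [e]; exact dvd_add (ha i j h) (hb i j h)
  neg_mem' := by
    intro a ha i j h
    have e : (-a) i - (-a) j = -(a i - a j) := by
      simp only [Pi.neg_apply]; ring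
    rw [e]; exact dvd_neg.mpr (ha i j h)
  mul_mem' := by
    intro a b ha hb i j h
    have e : (a * b) i - (a * b) j = a i * (b i - b j) + (a i - a j) * b j := by
      simp only [Pi.mul_apply]; ring
    rw [e]; exact dvd_add ((hb i j h).mul_left _) ((ha i j h).mul_right _)

/-- The graph equivariant cohomology H*(GQ_{2n−2}) (edges i j with j ≠ bar i only). -/
def HGQe (n : ℕ) : Subring (Fin (2*n) → Rr n) where
  carrier := {f | ∀ i j : Fin (2*n), i ≠ j → j ≠ bar i → ax i j ∣ f i - f j}
  zero_mem' := fun i j _ _ => by simp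
  one_mem' := fun i j _ _ => by simp
  add_mem' := by
    intro a b ha hb i j h h'
    have e : (a + b) i - (a + b) j = (a i - a j) + (b i - b j) := by
      simp only [Pi.add_apply]; ring
    rw [e]; exact dvd_add (ha i j h h') (hb i j h h')
  neg_mem' := by
    intro a ha i j h h'
    have e : (-a) i - (-a) j = -(a i - a j) := by
      simp only [Pi.neg_apply]; ring
    rw [e]; exact dvd_neg.mpr (ha i j h h')
  mul_mem' := by
    intro a b ha hb i j h h'
    have e : (a * b) i - (a * b) j = a i * (b i - b j) + (a i - a j) * b j := by
      simp only [Pi.mul_apply]; ring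
    rw [e]; exact dvd_add ((hb i j h h').mul_left _) ((ha i j h h').mul_right _)


theorem bar_bar {n : ℕ} (i : Fin (2*n)) : bar (bar i) = i := by
  ext
  have := i.isLt
  simp only [bar]
  omega

theorem bar_eq_iff {n : ℕ} {i j : Fin (2*n)} : bar i = j ↔ i = bar j := by
  constructor
  · rintro rfl
    exact (bar_bar i).symm
  · rintro rfl
    exact bar_bar j

theorem bar_injective {n : ℕ} : Function.Injective (bar : Fin (2*n) → Fin (2*n)) :=
  Function.Involutive.injective bar_bar

theorem av_bar {n : ℕ} (i : Fin (2*n)) : av (bar i) = -av i := by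
  have hi := i.isLt
  by_cases h : i.val < n
  · have h' : ¬ (bar i).val < n := by
      simp only [bar]
      omega
    have e : 2 * n - 1 - (bar i).val = i.val := by
      simp only [bar]
      omega
    simp only [av, dif_pos h, dif_neg h', e]
  · have h' : (bar i).val < n := by
      simp only [bar]
      omega
    rw [av, av, dif_pos h', dif_neg h, neg_neg]
    rfl

theorem ax_symm {n : ℕ} (i j : Fin (2*n)) : ax j i = -ax i j := by
  by_cases h : j = bar i
  · subst h
    simp [ax, bar_bar, av_bar]
  · have h' : i ≠ bar j := fun e => h (bar_eq_iff.mp e.symm)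
    simp only [ax, h, h', if_false]
    ring

theorem Finset.dvd_prod_sub_prod {ι R : Type*} [CommRing R] {d : R} {f g : ι → R}
    (s : Finset ι) (h : ∀ k ∈ s, d ∣ f k - g k) : d ∣ ∏ k ∈ s, f k - ∏ k ∈ s, g k := by
  simp only [← Ideal.mem_span_singleton, ← Ideal.Quotient.eq, map_prod] at h ⊢
  exact Finset.prod_congr rfl h

/-- Modulo `ax i j`, exchanging `bar i` and `bar j` matches the weights at `i` with those
at `j`. -/
theorem ax_dvd_ax_sub_ax_swap {n : ℕ} {i j : Fin (2*n)} (hij : i ≠ j) (hb : j ≠ bar i)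
    (k : Fin (2*n)) :
    ax i j ∣ ax i k - ax j (Equiv.swap (bar i) (bar j) k) := by
  have hbij : bar i ≠ bar j := bar_injective.ne hij
  have e : ax i j = -av i + av j := if_neg hb
  rw [e]
  by_cases h1 : k = bar i
  · subst h1
    rw [Equiv.swap_apply_left]
    simp only [ax, if_true]
    exact ⟨1, by ring⟩
  by_cases h2 : k = bar j
  · subst h2
    rw [Equiv.swap_apply_right]
    simp only [ax, hbij, hbij.symm, if_false, av_bar]
    exact ⟨0, by ring⟩
  rw [Equiv.swap_apply_of_ne_of_ne h1 h2]
  simp only [ax, h1, h2, if_false]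
  exact ⟨1, by ring⟩

theorem indep.bar_notMem {n : ℕ} {K : Finset (Fin (2*n))} (hK : indep K) {i : Fin (2*n)}
    (hi : i ∈ K) : bar i ∉ K := fun h =>
  hK i (Finset.insert_subset hi (Finset.singleton_subset_iff.mpr h))

theorem indep.prod_ax_swap {n : ℕ} {K : Finset (Fin (2*n))} (hK : indep K) {i j : Fin (2*n)}
    (hi : i ∈ K) (hj : j ∈ K) :
    ∏ k ∈ Kᶜ, ax j (Equiv.swap (bar i) (bar j) k) = ∏ k ∈ Kᶜ, ax j k := by
  refine Equiv.Perm.prod_comp _ _ (ax j) fun k hk => ?_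
  rw [Finset.mem_coe, Finset.mem_compl]
  intro hkK
  refine hk (Equiv.swap_apply_of_ne_of_ne ?_ ?_)
  · rintro rfl
    exact hK.bar_notMem hi hkK
  · rintro rfl
    exact hK.bar_notMem hj hkK

/-- For every nonempty independent K ⊆ V, Δ_K ∈ H*(GQ_{2n−1}). -/
theorem stmt2 (n : ℕ) (hn : 1 ≤ n) (K : Finset (Fin (2*n)))
    (hK1 : K.Nonempty) (hK2 : indep K) :
    Del K ∈ HGQ n := by
  intro i j hij
  simp only [Del]
  by_cases hi : i ∈ K <;> by_cases hj : j ∈ K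
  · have hb : j ≠ bar i := fun e => hK2.bar_notMem hi (e ▸ hj)
    rw [if_pos hi, if_pos hj, ← hK2.prod_ax_swap hi hj]
    exact Finset.dvd_prod_sub_prod _ fun k _ => ax_dvd_ax_sub_ax_swap hij hb k
  · rw [if_pos hi, if_neg hj, sub_zero]
    exact Finset.dvd_prod_of_mem _ (Finset.mem_compl.mpr hj)
  · rw [if_neg hi, if_pos hj, zero_sub, dvd_neg, ← neg_dvd, ← ax_symm]
    exact Finset.dvd_prod_of_mem _ (Finset.mem_compl.mpr hi)
  · rw [if_neg hi, if_neg hj, sub_zero]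
    exact dvd_zero _

end
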